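/- Consider a layered interval structure with levels 0,…,L+1 over the time horizon {0,…,T−1} with potential function φ, let ε be a real with 0 < ε ≤ 1/4, and define the space allocation s_{i,t} = ε^{-1}·(log₂(φ_{i,j_i(t)} / φ_{i+1,j_{i+1}(t)}) + 5·log₂(1/ε)) for 0 ≤ i ≤ L and t < T. Fix a level 0 ≤ i ≤ L and an index j < ℓ_i, and let W be a finite set of times contained in the interval I_{i,j} such that for every index m < ℓ_{i+1}, the number of elements of W lying in the level-(i+1) interval I_{i+1,m} is at most 3·ε^{-2} + 2. Then Σ_{t ∈ W} 2^{−ε·s_{i,t}} ≤ 1/4. -/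

import Mathlib

open Finset

/-- A layered interval structure with levels `0, …, L+1` over the time horizon
`{0, …, T−1}`: at each level `i ≤ L+1` there are `len i ≥ 1` intervals determined by
strictly increasing breakpoints `0 = bp i 0 < bp i 1 < ⋯ < bp i (len i) = T`. -/
structure LayeredIntervalStructure (L T : ℕ) where
  len : ℕ → ℕ
  bp : ℕ → ℕ → ℕ
  len_pos : ∀ i, i ≤ L + 1 → 0 < len i
  bp_zero : ∀ i, i ≤ L + 1 → bp i 0 = 0
  bp_last : ∀ i, i ≤ L + 1 → bp i (len i) = T
  bp_mono : ∀ i, i ≤ L + 1 → ∀ j, j < len i → bp i j < bp i (j + 1)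

/-- The `j`-th interval at level `i`: `I i j = {bp i j, …, bp i (j+1) − 1}`. -/
def LayeredIntervalStructure.interval {L T : ℕ} (S : LayeredIntervalStructure L T)
    (i j : ℕ) : Finset ℕ :=
  Finset.Ico (S.bp i j) (S.bp i (j + 1))

/-- `φ` is the potential function of the structure: every bottom-level (level `L+1`)
interval has potential `1`, and the potential of an interval at level `i ≤ L` is the
sum of the potentials of all level-(`i+1`) intervals intersecting it. -/
def LayeredIntervalStructure.IsPotential {L T : ℕ} (S : LayeredIntervalStructure L T)
    (φ : ℕ → ℕ → ℕ) : Prop :=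
  (∀ j, j < S.len (L + 1) → φ (L + 1) j = 1) ∧
  (∀ i, i ≤ L → ∀ j, j < S.len i → φ i j =
    ∑ m ∈ (Finset.range (S.len (i + 1))).filter
        (fun m => (S.interval (i + 1) m ∩ S.interval i j).Nonempty),
      φ (i + 1) m)

namespace LayeredIntervalStructure

variable {L T : ℕ} (S : LayeredIntervalStructure L T)

theorem bp_le_bp {i : ℕ} (hi : i ≤ L + 1) {a b : ℕ} (hab : a ≤ b) (hb : b ≤ S.len i) :
    S.bp i a ≤ S.bp i b := by
  induction b, hab using Nat.le_induction with
  | base => exact le_rfl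
  | succ b _ ih => exact (ih (by omega)).trans (S.bp_mono i hi b (by omega)).le

theorem lt_of_mem_interval {i : ℕ} (hi : i ≤ L + 1) {j t : ℕ} (hj : j < S.len i)
    (ht : t ∈ S.interval i j) : t < T := by
  have h := (Finset.mem_Ico.mp ht).2
  have h' := S.bp_le_bp hi (Nat.add_one_le_iff.mpr hj) le_rfl
  rw [S.bp_last i hi] at h'
  exact h.trans_le h'

theorem bp_mem_interval {i : ℕ} (hi : i ≤ L + 1) {j : ℕ} (hj : j < S.len i) :
    S.bp i j ∈ S.interval i j :=
  Finset.mem_Ico.mpr ⟨le_rfl, S.bp_mono i hi j hj⟩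

theorem index_unique {i : ℕ} (hi : i ≤ L + 1) {j k t : ℕ} (hj : j < S.len i) (hk : k < S.len i)
    (htj : t ∈ S.interval i j) (htk : t ∈ S.interval i k) : j = k := by
  have h₁ := Finset.mem_Ico.mp htj
  have h₂ := Finset.mem_Ico.mp htk
  rcases lt_trichotomy j k with h | h | h
  · have := S.bp_le_bp hi (Nat.add_one_le_iff.mpr h) hk.le
    omega
  · exact h
  · have := S.bp_le_bp hi (Nat.add_one_le_iff.mpr h) hj.le
    omega

theorem exists_mem_interval {i : ℕ} (hi : i ≤ L + 1) {t : ℕ} (ht : t < T) :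
    ∃ j < S.len i, t ∈ S.interval i j := by
  have hex : ∃ n, n ≤ S.len i ∧ t < S.bp i n := ⟨S.len i, le_rfl, by rwa [S.bp_last i hi]⟩
  classical
  obtain ⟨hle, hlt⟩ := Nat.find_spec hex
  have hpos : Nat.find hex ≠ 0 := by
    intro h
    rw [h, S.bp_zero i hi] at hlt
    omega
  obtain ⟨n, hn⟩ := Nat.exists_eq_succ_of_ne_zero hpos
  have hmin := Nat.find_min hex (m := n) (by omega)
  rw [hn] at hle hlt
  refine ⟨n, hle, Finset.mem_Ico.mpr ⟨?_, hlt⟩⟩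
  by_contra! h
  exact hmin ⟨by omega, h⟩

theorem IsPotential.pos {S : LayeredIntervalStructure L T} {φ : ℕ → ℕ → ℕ}
    (hφ : S.IsPotential φ) {i : ℕ} (hi : i ≤ L + 1) : ∀ j < S.len i, 0 < φ i j := by
  induction hi using Nat.decreasingInduction with
  | self => exact fun j hj => by simp [hφ.1 j hj]
  | of_succ i hi ih =>
    intro j hj
    rw [hφ.2 i (by omega) j hj]
    have hmem := S.bp_mem_interval (i := i) (by omega) hj
    obtain ⟨m, hm, htm⟩ := S.exists_mem_interval (i := i + 1) (by omega)
      (S.lt_of_mem_interval (by omega) hj hmem)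
    refine Finset.sum_pos (fun k hk => ih k ?_) ⟨m, ?_⟩
    · exact Finset.mem_range.mp (Finset.mem_filter.mp hk).1
    · exact Finset.mem_filter.mpr
        ⟨Finset.mem_range.mpr hm, S.bp i j, Finset.mem_inter.mpr ⟨htm, hmem⟩⟩

end LayeredIntervalStructure

theorem two_rpow_neg_logb_add {ε a b : ℝ} (hε : 0 < ε) (ha : 0 < a) (hb : 0 < b) :
    (2 : ℝ) ^ (-(ε * (ε⁻¹ * (Real.logb 2 (a / b) + 5 * Real.logb 2 (1 / ε))))) =
      b / a * ε ^ 5 := by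
  have h : -(ε * (ε⁻¹ * (Real.logb 2 (a / b) + 5 * Real.logb 2 (1 / ε)))) =
      Real.logb 2 (b / a * ε ^ 5) := by
    rw [mul_inv_cancel_left₀ hε.ne', Real.logb_mul (by positivity) (by positivity),
      Real.logb_pow, one_div, Real.logb_inv, ← inv_div b a, Real.logb_inv]
    push_cast
    ring
  rw [h, Real.rpow_logb two_pos (by norm_num) (by positivity)]


/-- **Feasibility of the offline space allocation.**
With `jdx i t` the unique index of the level-`i` interval containing time `t`, and the
space allocation `s i t = ε⁻¹·(log₂(φ i (jdx i t) / φ (i+1) (jdx (i+1) t)) + 5·log₂(1/ε))`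
for `0 < ε ≤ 1/4`: for any level `i ≤ L`, any index `j < len i`, and any finite set `W`
of times contained in the level-`i` interval `I i j` such that every level-(`i+1`)
interval contains at most `3·ε⁻² + 2` elements of `W`, one has
`Σ_{t ∈ W} 2^(−ε·s i t) ≤ 1/4`. -/
theorem space_sequence_feasible {L T : ℕ} (hT : 1 ≤ T)
    (S : LayeredIntervalStructure L T) (φ : ℕ → ℕ → ℕ) (hφ : S.IsPotential φ)
    (ε : ℝ) (hε0 : 0 < ε) (hε1 : ε ≤ 1 / 4)
    (jdx : ℕ → ℕ → ℕ)
    (hjdx : ∀ i, i ≤ L + 1 → ∀ t, t < T →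
      jdx i t < S.len i ∧ t ∈ S.interval i (jdx i t))
    (s : ℕ → ℕ → ℝ)
    (hs : ∀ i t, s i t = ε⁻¹ *
      (Real.logb 2 ((φ i (jdx i t) : ℝ) / (φ (i + 1) (jdx (i + 1) t) : ℝ)) +
        5 * Real.logb 2 (1 / ε)))
    (i : ℕ) (hi : i ≤ L) (j : ℕ) (hj : j < S.len i)
    (W : Finset ℕ) (hW : W ⊆ S.interval i j)
    (hcount : ∀ m, m < S.len (i + 1) →
      ((W ∩ S.interval (i + 1) m).card : ℝ) ≤ 3 / ε ^ 2 + 2) :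
    ∑ t ∈ W, (2 : ℝ) ^ (-(ε * s i t)) ≤ 1 / 4 := by
  have hφj : (0 : ℝ) < φ i j := by exact_mod_cast hφ.pos (by omega) j hj
  have hlt : ∀ t ∈ W, t < T := fun t ht => S.lt_of_mem_interval (by omega) hj (hW ht)
  have hterm : ∀ t ∈ W, (2 : ℝ) ^ (-(ε * s i t)) =
      (φ (i + 1) (jdx (i + 1) t) : ℝ) / φ i j * ε ^ 5 := by
    intro t ht
    obtain ⟨h₁, h₂⟩ := hjdx i (by omega) t (hlt t ht)
    have h₃ := (hjdx (i + 1) (by omega) t (hlt t ht)).1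
    have hpos : (0 : ℝ) < φ (i + 1) (jdx (i + 1) t) := by
      exact_mod_cast hφ.pos (by omega) _ h₃
    rw [hs, S.index_unique (by omega) h₁ hj h₂ (hW ht), two_rpow_neg_logb_add hε0 hφj hpos]
  set M := (Finset.range (S.len (i + 1))).filter
    (fun m => (S.interval (i + 1) m ∩ S.interval i j).Nonempty) with hM
  have hmaps : ∀ t ∈ W, jdx (i + 1) t ∈ M := by
    intro t ht
    obtain ⟨h₁, h₂⟩ := hjdx (i + 1) (by omega) t (hlt t ht)
    exact Finset.mem_filter.mpr
      ⟨Finset.mem_range.mpr h₁, t, Finset.mem_inter.mpr ⟨h₂, hW ht⟩⟩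
  have hsum : (φ i j : ℝ) = ∑ m ∈ M, (φ (i + 1) m : ℝ) := by
    exact_mod_cast hφ.2 i hi j hj
  have hfiber : ∑ t ∈ W, (φ (i + 1) (jdx (i + 1) t) : ℝ) ≤ (3 / ε ^ 2 + 2) * φ i j := by
    rw [← Finset.sum_fiberwise_of_maps_to hmaps, hsum, Finset.mul_sum]
    refine Finset.sum_le_sum fun m hm => ?_
    have hm' : m < S.len (i + 1) := Finset.mem_range.mp (Finset.mem_filter.mp hm).1
    have hsub : W.filter (fun t => jdx (i + 1) t = m) ⊆ W ∩ S.interval (i + 1) m := by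
      intro t ht
      obtain ⟨htW, rfl⟩ := Finset.mem_filter.mp ht
      exact Finset.mem_inter.mpr ⟨htW, (hjdx (i + 1) (by omega) t (hlt t htW)).2⟩
    have hcard : ((W.filter (fun t => jdx (i + 1) t = m)).card : ℝ) ≤ 3 / ε ^ 2 + 2 :=
      (Nat.cast_le.mpr (Finset.card_le_card hsub)).trans (hcount m hm')
    rw [Finset.sum_congr rfl (g := fun _ => (φ (i + 1) m : ℝ))
      (fun t ht => by rw [(Finset.mem_filter.mp ht).2]), Finset.sum_const, nsmul_eq_mul]
    gcongr
  calc ∑ t ∈ W, (2 : ℝ) ^ (-(ε * s i t))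
      = (∑ t ∈ W, (φ (i + 1) (jdx (i + 1) t) : ℝ)) / φ i j * ε ^ 5 := by
        rw [Finset.sum_congr rfl hterm, ← Finset.sum_mul, ← Finset.sum_div]
    _ ≤ ((3 / ε ^ 2 + 2) * φ i j) / φ i j * ε ^ 5 := by gcongr
    _ = 3 * ε ^ 3 + 2 * ε ^ 5 := by
        field_simp
    _ ≤ 3 * (1 / 4) ^ 3 + 2 * (1 / 4) ^ 5 := by gcongr
    _ ≤ 1 / 4 := by norm_num
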